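/- Let E = (E¹,E²,E³) ∈ L¹_loc(ℝ³) such that y ↦ M_{ij}(x,y) E^j(y) is integrable for a.e. x ∈ ℝ³, where M_{ij}(x,y) := (1/(16π|x-y|)) ( (x_i-y_i)(x_j-y_j)/|x-y|² + 3δ_{ij} ). Then W^i(x) := ∫_{ℝ³} M_{ij}(x,y) E^j(y) dy defines an L¹_loc vector field solving -ΔW^i - ∂_i(∂_j W^j) = E^i in the sense of distributions. -/

import Mathlib

open MeasureTheory Filter
open scoped BigOperators Topology RealInnerProductSpace

noncomputable section

abbrev E3 : Type := EuclideanSpace ℝ (Fin 3)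

/-- Partial derivative in the `i`-th coordinate direction. -/
noncomputable def pd (i : Fin 3) (f : E3 → ℝ) (x : E3) : ℝ :=
  fderiv ℝ f x (EuclideanSpace.single i 1)

/-- Euclidean Laplacian on `ℝ³`. -/
noncomputable def lap (f : E3 → ℝ) (x : E3) : ℝ :=
  ∑ i : Fin 3, pd i (pd i f) x

/-- The kernel `M_{ij}(x,y) = (1/(16π|x-y|)) ( (x_i-y_i)(x_j-y_j)/|x-y|² + 3δ_{ij} )`. -/
noncomputable def Mker (i j : Fin 3) (x y : E3) : ℝ :=
  (1 / (16 * Real.pi * ‖x - y‖))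
    * ((x i - y i) * (x j - y j) / ‖x - y‖ ^ 2 + 3 * (if i = j then (1 : ℝ) else 0))

/-- `W^i(x) = ∫ M_{ij}(x,y) E^j(y) dy` (summed over `j`). -/
noncomputable def Wsol (Evec : Fin 3 → E3 → ℝ) (i : Fin 3) (x : E3) : ℝ :=
  ∑ j : Fin 3, ∫ y : E3, Mker i j x y * Evec j y

/-- the regularised power `(‖z‖² + ε²)^p`. -/
def Qr (ε p : ℝ) (z : E3) : ℝ := (‖z‖ ^ 2 + ε ^ 2) ^ p

lemma Qbase_pos {ε : ℝ} (hε : 0 < ε) (z : E3) : 0 < ‖z‖ ^ 2 + ε ^ 2 := by positivity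

lemma contDiff_Qr {ε : ℝ} (hε : 0 < ε) (p : ℝ) : ContDiff ℝ (⊤ : ℕ∞) (Qr ε p) := by
  unfold Qr
  refine ContDiff.rpow_const_of_ne ?_ (fun z => (Qbase_pos hε z).ne')
  exact (contDiff_norm_sq ℝ).add contDiff_const

lemma contDiff_coord (i : Fin 3) : ContDiff ℝ (⊤ : ℕ∞) (fun z : E3 => z i) := by
  exact (EuclideanSpace.proj i : E3 →L[ℝ] ℝ).contDiff

lemma pd_Qr {ε : ℝ} (hε : 0 < ε) (p : ℝ) (i : Fin 3) :
    pd i (Qr ε p) = fun z => 2 * p * (z i * Qr ε (p - 1) z) := by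
  funext z
  have h1 : HasFDerivAt (fun z : E3 => ‖z‖ ^ 2 + ε ^ 2) (2 • (innerSL ℝ z)) z := by
    simpa using (hasStrictFDerivAt_norm_sq z).hasFDerivAt.add_const (ε ^ 2)
  have h2 := h1.rpow_const (p := p) (Or.inl (Qbase_pos hε z).ne')
  unfold pd
  rw [show Qr ε p = fun z : E3 => (‖z‖ ^ 2 + ε ^ 2) ^ p from rfl, h2.fderiv]
  simp [Qr, EuclideanSpace.inner_single_right]
  ring

lemma pd_coord_mul {f : E3 → ℝ} (hf : ContDiff ℝ (⊤ : ℕ∞) f) (i j : Fin 3) :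
    pd j (fun z => z i * f z) = fun z => (if i = j then 1 else 0) * f z + z i * pd j f z := by
  funext z
  have h1 : HasFDerivAt (fun z : E3 => z i)
      (EuclideanSpace.proj i : E3 →L[ℝ] ℝ) z :=
    (EuclideanSpace.proj i : E3 →L[ℝ] ℝ).hasFDerivAt
  have h2 := h1.mul ((hf.differentiable (by simp)) z).hasFDerivAt
  unfold pd
  rw [show (fun z : E3 => z i * f z) = (fun z : E3 => z i) * f from rfl, h2.fderiv]
  simp
  ring

lemma contDiff_pd {f : E3 → ℝ} (hf : ContDiff ℝ (⊤ : ℕ∞) f) (i : Fin 3) :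
    ContDiff ℝ (⊤ : ℕ∞) (pd i f) := by
  have := hf.fderiv_right (m := (⊤ : ℕ∞)) (by simp)
  exact this.clm_apply contDiff_const

lemma hcs_pd {f : E3 → ℝ} (hf : HasCompactSupport f) (i : Fin 3) :
    HasCompactSupport (pd i f) := hf.fderiv_apply (𝕜 := ℝ) _

lemma pd_const_mul {f : E3 → ℝ} (hf : ContDiff ℝ (⊤ : ℕ∞) f) (c : ℝ) (i : Fin 3) :
    pd i (fun z => c * f z) = fun z => c * pd i f z := by
  funext z
  unfold pd
  rw [fderiv_const_mul ((hf.differentiable (by simp)) z)]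
  simp

lemma pd_sum {f : Fin 3 → E3 → ℝ} (hf : ∀ k, ContDiff ℝ (⊤ : ℕ∞) (f k)) (i : Fin 3) :
    pd i (fun z => ∑ k, f k z) = fun z => ∑ k, pd i (f k) z := by
  funext z
  unfold pd
  rw [fderiv_fun_sum (fun k _ => ((hf k).differentiable (by simp)) z)]
  simp

lemma pd_comm {f : E3 → ℝ} (hf : ContDiff ℝ (⊤ : ℕ∞) f) (i j : Fin 3) :
    pd i (pd j f) = pd j (pd i f) := by
  funext z
  have hs : IsSymmSndFDerivAt ℝ f z :=
    (hf.contDiffAt).isSymmSndFDerivAt (by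
      rw [minSmoothness_of_isRCLikeNormedField]; exact WithTop.coe_le_coe.2 (le_top : (2 : ℕ∞) ≤ ⊤))
  have hd : Differentiable ℝ (fderiv ℝ f) :=
    (hf.fderiv_right (m := (⊤ : ℕ∞)) (by simp)).differentiable (by simp)
  have key : ∀ a b : Fin 3, pd a (pd b f) z
      = fderiv ℝ (fderiv ℝ f) z (EuclideanSpace.single a 1) (EuclideanSpace.single b 1) := by
    intro a b
    unfold pd
    rw [fderiv_clm_apply (hd z) (differentiableAt_const _)]
    simp
  rw [key, key]
  exact hs _ _

lemma pd_pd_Qr {ε : ℝ} (hε : 0 < ε) (p : ℝ) (i j : Fin 3) :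
    pd j (pd i (Qr ε p)) = fun z => 2 * p * ((if i = j then 1 else 0) * Qr ε (p - 1) z
      + 2 * (p - 1) * (z i * z j) * Qr ε (p - 2) z) := by
  rw [pd_Qr hε, pd_const_mul ((contDiff_coord i).mul (contDiff_Qr hε _)),
    pd_coord_mul (contDiff_Qr hε _), pd_Qr hε]
  funext z
  rw [show p - 1 - 1 = p - 2 by ring]
  ring

lemma integrable_mul_test {f g : E3 → ℝ} (hf : Continuous f) (hg : Continuous g)
    (hc : HasCompactSupport g) : Integrable (fun z => f z * g z) :=
  (hf.mul hg).integrable_of_hasCompactSupport hc.mul_left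

lemma ibp {f g : E3 → ℝ} (hf : ContDiff ℝ (⊤ : ℕ∞) f) (hg : ContDiff ℝ (⊤ : ℕ∞) g)
    (hc : HasCompactSupport g) (i : Fin 3) :
    ∫ z, f z * pd i g z = - ∫ z, pd i f z * g z :=
  integral_mul_fderiv_eq_neg_fderiv_mul_of_integrable
    (integrable_mul_test (contDiff_pd hf i).continuous hg.continuous hc)
    (integrable_mul_test hf.continuous (contDiff_pd hg i).continuous (hcs_pd hc i))
    (integrable_mul_test hf.continuous hg.continuous hc)
    (fun z _ => (hf.differentiable (by simp)) z) (fun z _ => (hg.differentiable (by simp)) z)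

lemma ibp2 {f g : E3 → ℝ} (hf : ContDiff ℝ (⊤ : ℕ∞) f) (hg : ContDiff ℝ (⊤ : ℕ∞) g)
    (hc : HasCompactSupport g) (i j : Fin 3) :
    ∫ z, f z * pd i (pd j g) z = ∫ z, pd j (pd i f) z * g z := by
  rw [ibp hf (contDiff_pd hg j) (hcs_pd hc j), ibp (contDiff_pd hf i) hg hc, neg_neg]

/-- local part of `1/|z|` -/
def kloc : E3 → ℝ := (Metric.ball (0 : E3) 1).indicator (fun z => ‖z‖⁻¹)

lemma integrable_kloc : Integrable kloc := by
  unfold kloc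
  rw [integrable_indicator_iff measurableSet_ball]
  rw [integrableOn_fun_norm_addHaar volume (f := fun r => r⁻¹)]
  have h : IntegrableOn (fun y : ℝ => y) (Set.Ioo 0 1) :=
    (continuous_id.integrableOn_Icc (a := (0:ℝ)) (b := 1)).mono_set Set.Ioo_subset_Icc_self
  refine h.congr_fun (fun y hy => ?_) measurableSet_Ioo
  have := hy.1.ne'
  simp
  field_simp

lemma kloc_nonneg (z : E3) : 0 ≤ kloc z :=
  Set.indicator_nonneg (fun _ _ => by positivity) z

lemma inv_norm_le (z : E3) : ‖z‖⁻¹ ≤ kloc z + 1 := by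
  unfold kloc
  by_cases h : z ∈ Metric.ball (0 : E3) 1
  · rw [Set.indicator_of_mem h]; linarith
  · rw [Set.indicator_of_notMem h]
    have : 1 ≤ ‖z‖ := by simpa using h
    linarith [inv_le_one_of_one_le₀ this]

lemma integrable_inv_mul {g : E3 → ℝ} (hg : Continuous g) (hc : HasCompactSupport g) :
    Integrable (fun z => ‖z‖⁻¹ * ‖g z‖) := by
  obtain ⟨C, hC⟩ := hc.exists_bound_of_continuous hg
  refine ((integrable_kloc.const_mul C).add (hg.integrable_of_hasCompactSupport hc).norm).mono'
    (by fun_prop) (ae_of_all _ fun z => ?_)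
  rw [Real.norm_of_nonneg (by positivity)]
  have h1 := mul_le_mul_of_nonneg_right (inv_norm_le z) (norm_nonneg (g z))
  have h2 := mul_le_mul_of_nonneg_left (hC z) (kloc_nonneg z)
  simp only [Pi.add_apply]
  linarith
def epsn (n : ℕ) : ℝ := 1 / ((n : ℝ) + 1)

lemma epsn_pos (n : ℕ) : 0 < epsn n := by unfold epsn; positivity

lemma epsn_le_one (n : ℕ) : epsn n ≤ 1 := by
  unfold epsn
  rw [div_le_one (by positivity)]
  have : (0 : ℝ) ≤ n := by positivity
  linarith

lemma epsn_tendsto : Tendsto epsn atTop (𝓝 0) := tendsto_one_div_add_atTop_nhds_zero_nat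

lemma Qr_tendsto {z : E3} (hz : z ≠ 0) (p : ℝ) :
    Tendsto (fun n => Qr (epsn n) p z) atTop (𝓝 ((‖z‖ ^ 2) ^ p)) := by
  unfold Qr
  have h0 : ‖z‖ ^ 2 ≠ 0 := by simpa using hz
  have h : Tendsto (fun n => ‖z‖ ^ 2 + epsn n ^ 2) atTop (𝓝 (‖z‖ ^ 2)) := by
    simpa using tendsto_const_nhds.add (epsn_tendsto.pow 2)
  exact h.rpow_const (Or.inl h0)

lemma pow_neg_half (z : E3) : (‖z‖ ^ 2) ^ (-(1 / 2) : ℝ) = ‖z‖⁻¹ := by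
  rw [← Real.rpow_natCast_mul (norm_nonneg z)]
  norm_num [Real.rpow_neg_one]

lemma pow_neg_three_half (z : E3) : (‖z‖ ^ 2) ^ (-(3 / 2) : ℝ) = ‖z‖⁻¹ ^ 3 := by
  rw [← Real.rpow_natCast_mul (norm_nonneg z)]
  rw [show ((2 : ℕ) : ℝ) * -(3 / 2) = -((3 : ℕ) : ℝ) by norm_num,
    Real.rpow_neg (norm_nonneg z), Real.rpow_natCast, inv_pow]

lemma pow_half (z : E3) : (‖z‖ ^ 2) ^ ((1 / 2) : ℝ) = ‖z‖ := by
  rw [← Real.rpow_natCast_mul (norm_nonneg z)]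
  norm_num

lemma Qr_le {z : E3} (hz : z ≠ 0) (ε : ℝ) {p : ℝ} (hp : p ≤ 0) :
    Qr ε p z ≤ (‖z‖ ^ 2) ^ p := by
  have h0 : 0 < ‖z‖ := by simpa using hz
  exact Real.rpow_le_rpow_of_nonpos (by positivity) (by nlinarith [sq_nonneg ε]) hp

lemma Qr_nonneg (ε p : ℝ) (z : E3) : 0 ≤ Qr ε p z := by unfold Qr; positivity

lemma coord_le (z : E3) (i : Fin 3) : |z i| ≤ ‖z‖ := by
  simpa using PiLp.norm_apply_le z i

lemma ae_ne_zero : ∀ᵐ z : E3, z ≠ 0 := Measure.ae_ne volume 0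

def Hk (i j : Fin 3) (z : E3) : ℝ :=
  (if i = j then 1 else 0) * ‖z‖⁻¹ - z i * z j * ‖z‖⁻¹ ^ 3

lemma hess_bound (a b : ℝ) {z : E3} (i j : Fin 3) (hz : z ≠ 0) (ha : 0 ≤ a) (hb : 0 ≤ b)
    (ha' : a ≤ ‖z‖⁻¹) (hb' : b ≤ ‖z‖⁻¹ ^ 3) :
    |(if i = j then 1 else 0) * a - z i * z j * b| ≤ 2 * ‖z‖⁻¹ := by
  have h0 : 0 < ‖z‖ := by simpa using hz
  have h1 : |z i * z j| ≤ ‖z‖ * ‖z‖ := by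
    rw [abs_mul]
    exact mul_le_mul (coord_le z i) (coord_le z j) (abs_nonneg _) (norm_nonneg _)
  have h2 : |z i * z j * b| ≤ ‖z‖⁻¹ := by
    rw [abs_mul, abs_of_nonneg hb]
    calc |z i * z j| * b ≤ (‖z‖ * ‖z‖) * ‖z‖⁻¹ ^ 3 :=
          mul_le_mul h1 hb' hb (by positivity)
      _ = ‖z‖⁻¹ := by field_simp
  have h3 : |(if i = j then 1 else 0) * a| ≤ ‖z‖⁻¹ := by
    split_ifs
    · rw [one_mul, abs_of_nonneg ha]; exact ha'
    · simp
  rw [abs_le] at h2 h3 ⊢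
  constructor <;> linarith [h2.1, h2.2, h3.1, h3.2]

lemma Hk_bound (i j : Fin 3) (z : E3) : |Hk i j z| ≤ 2 * ‖z‖⁻¹ := by
  by_cases hz : z = 0
  · simp [Hk, hz]
  · exact hess_bound _ _ i j hz (by positivity) (by positivity) le_rfl le_rfl

lemma measurable_Hk (i j : Fin 3) : Measurable (Hk i j) := by
  unfold Hk
  fun_prop

lemma integrable_Hk_mul (i j : Fin 3) {g : E3 → ℝ} (hg : Continuous g)
    (hc : HasCompactSupport g) : Integrable (fun z => Hk i j z * g z) := by
  refine ((integrable_inv_mul hg hc).const_mul 2).mono'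
    ((measurable_Hk i j).mul hg.measurable).aestronglyMeasurable (ae_of_all _ fun z => ?_)
  rw [norm_mul, ← mul_assoc]
  exact mul_le_mul_of_nonneg_right (Hk_bound i j z) (norm_nonneg _)

lemma integrable_inv_mul' {g : E3 → ℝ} (hg : Continuous g) (hc : HasCompactSupport g) :
    Integrable (fun z => ‖z‖⁻¹ * g z) := by
  refine (integrable_inv_mul hg hc).mono' (by fun_prop) (ae_of_all _ fun z => ?_)
  simp

lemma lemmaB {ψ : E3 → ℝ} (hψ : ContDiff ℝ (⊤ : ℕ∞) ψ) (hc : HasCompactSupport ψ)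
    (i j : Fin 3) : ∫ z, Hk i j z * ψ z = ∫ z, ‖z‖ * pd i (pd j ψ) z := by
  have hψ2 := (contDiff_pd (contDiff_pd hψ j) i).continuous
  have hc2 := hcs_pd (hcs_pd hc j) i
  have e : ∀ n, ∫ z, Qr (epsn n) (1 / 2) z * pd i (pd j ψ) z
      = ∫ z, ((if i = j then 1 else 0) * Qr (epsn n) (-(1 / 2)) z
        - z i * z j * Qr (epsn n) (-(3 / 2)) z) * ψ z := by
    intro n
    rw [ibp2 (contDiff_Qr (epsn_pos n) _) hψ hc, pd_pd_Qr (epsn_pos n)]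
    congr 1
    funext z
    rw [show (1 / 2 - 1 : ℝ) = -(1 / 2) by norm_num, show (1 / 2 - 2 : ℝ) = -(3 / 2) by norm_num]
    ring
  have l1 : Tendsto (fun n => ∫ z, Qr (epsn n) (1 / 2) z * pd i (pd j ψ) z) atTop
      (𝓝 (∫ z, ‖z‖ * pd i (pd j ψ) z)) := by
    refine tendsto_integral_of_dominated_convergence
      (fun z => (‖z‖ + 1) * ‖pd i (pd j ψ) z‖) (fun n => ?_) ?_ (fun n => ?_) ?_
    · exact ((contDiff_Qr (epsn_pos n) _).continuous.mul hψ2).aestronglyMeasurable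
    · exact integrable_mul_test (by fun_prop) hψ2.norm hc2.norm
    · refine ae_of_all _ fun z => ?_
      rw [norm_mul]
      refine mul_le_mul_of_nonneg_right ?_ (norm_nonneg _)
      rw [Real.norm_of_nonneg (Qr_nonneg _ _ _)]
      unfold Qr
      rw [← Real.sqrt_eq_rpow]
      apply Real.sqrt_le_iff.2 ⟨by positivity, ?_⟩
      have := epsn_pos n
      have := epsn_le_one n
      nlinarith [norm_nonneg z]
    · filter_upwards [ae_ne_zero] with z hz
      have := Qr_tendsto hz (1 / 2)
      rw [pow_half] at this
      exact this.mul_const _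
  have l2 : Tendsto (fun n => ∫ z, ((if i = j then 1 else 0) * Qr (epsn n) (-(1 / 2)) z
        - z i * z j * Qr (epsn n) (-(3 / 2)) z) * ψ z) atTop
      (𝓝 (∫ z, Hk i j z * ψ z)) := by
    refine tendsto_integral_of_dominated_convergence
      (fun z => 2 * (‖z‖⁻¹ * ‖ψ z‖)) (fun n => ?_) ?_ (fun n => ?_) ?_
    · have h1 := (contDiff_Qr (epsn_pos n) (-(1 / 2))).continuous
      have h2 := (contDiff_Qr (epsn_pos n) (-(3 / 2))).continuous
      have h3 := hψ.continuous
      exact Continuous.aestronglyMeasurable (by fun_prop)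
    · exact (integrable_inv_mul hψ.continuous hc).const_mul 2
    · filter_upwards [ae_ne_zero] with z hz
      rw [norm_mul, ← mul_assoc]
      refine mul_le_mul_of_nonneg_right ?_ (norm_nonneg _)
      refine hess_bound _ _ i j hz (Qr_nonneg _ _ _) (Qr_nonneg _ _ _) ?_ ?_
      · rw [← pow_neg_half]; exact Qr_le hz _ (by norm_num)
      · rw [← pow_neg_three_half]; exact Qr_le hz _ (by norm_num)
    · filter_upwards [ae_ne_zero] with z hz
      have t1 := Qr_tendsto hz (-(1 / 2))
      have t2 := Qr_tendsto hz (-(3 / 2))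
      rw [pow_neg_half] at t1
      rw [pow_neg_three_half] at t2
      exact ((t1.const_mul _).sub (t2.const_mul _)).mul_const _
  simp_rw [e] at l1
  exact tendsto_nhds_unique l2 l1

lemma norm_sq_sum (z : E3) : ∑ k, z k * z k = ‖z‖ ^ 2 := by
  rw [EuclideanSpace.norm_sq_eq]
  simp [sq]

lemma integrable_profile : Integrable (fun z : E3 => 3 * Qr 1 (-(5 / 2)) z) := by
  refine Integrable.const_mul ?_ 3
  have := integrable_rpow_neg_one_add_norm_sq (E := E3) (μ := volume) (r := 5) (by simp; norm_num)
  refine this.congr (ae_of_all _ fun z => ?_)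
  simp only [Qr]
  congr 1
  · ring
  · ring

lemma integral_profile : ∫ z : E3, 3 * Qr 1 (-(5 / 2)) z = 4 * Real.pi := by
  have h := integral_fun_norm_addHaar (volume : Measure E3)
    (fun r : ℝ => 3 * (r ^ 2 + 1 ^ 2) ^ (-(5 / 2) : ℝ))
  have h1 : ∫ y in Set.Ioi (0 : ℝ), y ^ 2 * (3 * (y ^ 2 + 1 ^ 2) ^ (-(5 / 2) : ℝ)) = 1 := by
    have hd : ∀ x ∈ Set.Ici (0 : ℝ), HasDerivAt (fun y : ℝ => y ^ 3 * (y ^ 2 + 1 ^ 2) ^ (-(3 / 2) : ℝ))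
        (x ^ 2 * (3 * (x ^ 2 + 1 ^ 2) ^ (-(5 / 2) : ℝ))) x := by
      intro x _
      have hp : 0 < x ^ 2 + 1 ^ 2 := by positivity
      have a := ((hasDerivAt_pow 2 x).add_const (1 ^ 2 : ℝ)).rpow_const (p := -(3 / 2))
        (Or.inl hp.ne')
      have b := (hasDerivAt_pow 3 x).mul a
      refine b.congr_deriv ?_
      have : (x ^ 2 + 1 ^ 2) ^ (-(3 / 2) : ℝ)
          = (x ^ 2 + 1 ^ 2) * (x ^ 2 + 1 ^ 2) ^ (-(5 / 2) : ℝ) := by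
        rw [← Real.rpow_one_add' hp.le (by norm_num)]
        norm_num
      rw [this, show (-(3 / 2) - 1 : ℝ) = -(5 / 2) by norm_num]
      norm_num
      ring
    have ht : Tendsto (fun y : ℝ => y ^ 3 * (y ^ 2 + 1 ^ 2) ^ (-(3 / 2) : ℝ)) atTop (𝓝 1) := by
      have : Tendsto (fun y : ℝ => (1 + (y⁻¹) ^ 2) ^ (-(3 / 2) : ℝ)) atTop (𝓝 1) := by
        have h0 : Tendsto (fun y : ℝ => 1 + (y⁻¹) ^ 2) atTop (𝓝 1) := by
          simpa using tendsto_const_nhds.add ((tendsto_inv_atTop_zero (𝕜 := ℝ)).pow 2)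
        simpa using h0.rpow_const (p := -(3 / 2)) (Or.inl one_ne_zero)
      refine this.congr' ?_
      filter_upwards [eventually_gt_atTop 0] with y hy
      rw [show y ^ 2 + 1 ^ 2 = y ^ 2 * (1 + (y⁻¹) ^ 2) by field_simp; try ring,
        Real.mul_rpow (by positivity) (by positivity), ← mul_assoc,
        ← Real.rpow_natCast_mul hy.le,
        show ((2 : ℕ) : ℝ) * -(3 / 2) = -((3 : ℕ) : ℝ) by norm_num,
        Real.rpow_neg hy.le, Real.rpow_natCast, mul_inv_cancel₀ (by positivity), one_mul]
    rw [integral_Ioi_of_hasDerivAt_of_nonneg' hd (fun x _ => by positivity) ht]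
    simp
  have hf : Module.finrank ℝ E3 = 3 := by simp
  rw [hf] at h
  simp only [Qr]
  rw [h]
  simp only [smul_eq_mul, Nat.reduceSub]
  rw [h1, Measure.real, EuclideanSpace.volume_ball_fin_three]
  rw [ENNReal.ofReal_one, one_pow, one_mul, ENNReal.toReal_ofReal (by positivity)]
  simp
  ring

lemma lap_cd {ψ : E3 → ℝ} (hψ : ContDiff ℝ (⊤ : ℕ∞) ψ) : ContDiff ℝ (⊤ : ℕ∞) (lap ψ) :=
  ContDiff.sum fun k _ => contDiff_pd (contDiff_pd hψ k) k

lemma lap_hcs {ψ : E3 → ℝ} (hc : HasCompactSupport ψ) : HasCompactSupport (lap ψ) := by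
  have : lap ψ = fun z => pd 0 (pd 0 ψ) z + pd 1 (pd 1 ψ) z + pd 2 (pd 2 ψ) z := by
    funext z; simp [lap, Fin.sum_univ_three]
  rw [this]
  exact ((hcs_pd (hcs_pd hc 0) 0).add (hcs_pd (hcs_pd hc 1) 1)).add (hcs_pd (hcs_pd hc 2) 2)

lemma newton_eps {ψ : E3 → ℝ} (hψ : ContDiff ℝ (⊤ : ℕ∞) ψ) (hc : HasCompactSupport ψ)
    {ε : ℝ} (hε : 0 < ε) :
    ∫ z, Qr ε (-(1 / 2)) z * lap ψ z = - ∫ w, 3 * Qr 1 (-(5 / 2)) w * ψ (ε • w) := by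
  have hQ := contDiff_Qr hε (-(1 / 2))
  have e1 : ∫ z, Qr ε (-(1 / 2)) z * lap ψ z
      = ∫ z, -(3 * ε ^ 2) * Qr ε (-(5 / 2)) z * ψ z := by
    simp only [lap, Finset.mul_sum]
    rw [integral_finsetSum _ fun k _ => integrable_mul_test hQ.continuous
      (contDiff_pd (contDiff_pd hψ k) k).continuous (hcs_pd (hcs_pd hc k) k)]
    simp_rw [ibp2 hQ hψ hc]
    rw [← integral_finsetSum _ fun k _ => integrable_mul_test
      (contDiff_pd (contDiff_pd hQ k) k).continuous hψ.continuous hc]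
    congr 1
    funext z
    rw [← Finset.sum_mul]
    congr 1
    simp only [pd_pd_Qr hε, if_true]
    have : Qr ε (-(3 / 2)) z = (‖z‖ ^ 2 + ε ^ 2) * Qr ε (-(5 / 2)) z := by
      unfold Qr
      rw [← Real.rpow_one_add' (by positivity) (by norm_num)]
      norm_num
    rw [show (-(1 / 2) - 1 : ℝ) = -(3 / 2) by norm_num,
      show (-(1 / 2) - 2 : ℝ) = -(5 / 2) by norm_num, this, ← norm_sq_sum, Fin.sum_univ_three,
      Fin.sum_univ_three]
    ring
  rw [e1, ← integral_neg]
  have e2 := Measure.integral_comp_smul (volume : Measure E3)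
    (fun z => -(3 * ε ^ 2) * Qr ε (-(5 / 2)) z * ψ z) ε
  have hf : Module.finrank ℝ E3 = 3 := by simp
  rw [hf, abs_of_pos (by positivity), smul_eq_mul] at e2
  have e3 : ∫ z, -(3 * ε ^ 2) * Qr ε (-(5 / 2)) z * ψ z
      = ε ^ 3 * ∫ z, -(3 * ε ^ 2) * Qr ε (-(5 / 2)) (ε • z) * ψ (ε • z) := by
    rw [e2]; field_simp
  rw [e3, ← integral_const_mul]
  congr 1
  funext w
  have : Qr ε (-(5 / 2)) (ε • w) = (ε ^ 5)⁻¹ * Qr 1 (-(5 / 2)) w := by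
    unfold Qr
    rw [norm_smul, Real.norm_of_nonneg hε.le,
      show (ε * ‖w‖) ^ 2 + ε ^ 2 = ε ^ 2 * (‖w‖ ^ 2 + 1 ^ 2) by ring,
      Real.mul_rpow (by positivity) (by positivity), ← Real.rpow_natCast_mul hε.le,
      show ((2 : ℕ) : ℝ) * -(5 / 2) = -((5 : ℕ) : ℝ) by norm_num,
      Real.rpow_neg hε.le, Real.rpow_natCast]
  rw [this]
  field_simp

lemma lemmaA {ψ : E3 → ℝ} (hψ : ContDiff ℝ (⊤ : ℕ∞) ψ) (hc : HasCompactSupport ψ) :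
    ∫ z, ‖z‖⁻¹ * lap ψ z = -(4 * Real.pi * ψ 0) := by
  have hl := (lap_cd hψ).continuous
  have l1 : Tendsto (fun n => ∫ z, Qr (epsn n) (-(1 / 2)) z * lap ψ z) atTop
      (𝓝 (∫ z, ‖z‖⁻¹ * lap ψ z)) := by
    refine tendsto_integral_of_dominated_convergence
      (fun z => ‖z‖⁻¹ * ‖lap ψ z‖) (fun n => ?_) ?_ (fun n => ?_) ?_
    · exact ((contDiff_Qr (epsn_pos n) _).continuous.mul hl).aestronglyMeasurable
    · exact integrable_inv_mul hl (lap_hcs hc)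
    · filter_upwards [ae_ne_zero] with z hz
      rw [norm_mul]
      refine mul_le_mul_of_nonneg_right ?_ (norm_nonneg _)
      rw [Real.norm_of_nonneg (Qr_nonneg _ _ _), ← pow_neg_half]
      exact Qr_le hz _ (by norm_num)
    · filter_upwards [ae_ne_zero] with z hz
      have t1 := Qr_tendsto hz (-(1 / 2))
      rw [pow_neg_half] at t1
      exact t1.mul_const _
  have l2 : Tendsto (fun n => ∫ w, 3 * Qr 1 (-(5 / 2)) w * ψ (epsn n • w)) atTop
      (𝓝 (∫ w, 3 * Qr 1 (-(5 / 2)) w * ψ 0)) := by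
    obtain ⟨C, hC⟩ := hc.exists_bound_of_continuous hψ.continuous
    refine tendsto_integral_of_dominated_convergence
      (fun z => (3 * Qr 1 (-(5 / 2)) z) * C) (fun n => ?_) ?_ (fun n => ?_) ?_
    · have h1 := (contDiff_Qr one_pos (-(5 / 2))).continuous
      have h3 := hψ.continuous
      exact Continuous.aestronglyMeasurable (by fun_prop)
    · exact integrable_profile.mul_const C
    · refine ae_of_all _ fun z => ?_
      have := Qr_nonneg 1 (-(5 / 2)) z
      rw [norm_mul, Real.norm_of_nonneg (by positivity)]
      exact mul_le_mul_of_nonneg_left (hC _) (by positivity)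
    · refine ae_of_all _ fun z => ?_
      have : Tendsto (fun n => epsn n • z) atTop (𝓝 0) := by
        simpa using epsn_tendsto.smul_const z
      exact ((hψ.continuous.tendsto 0).comp this).const_mul _
  simp_rw [newton_eps hψ hc (epsn_pos _)] at l1
  rw [integral_mul_const, integral_profile] at l2
  exact tendsto_nhds_unique l1 l2.neg
def Kk (i j : Fin 3) (z : E3) : ℝ :=
  (1 / (16 * Real.pi)) * (4 * ((if i = j then 1 else 0) * ‖z‖⁻¹) - Hk i j z)

lemma Mker_eq (i j : Fin 3) (x y : E3) : Mker i j x y = Kk i j (x - y) := by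
  have hpi := Real.pi_ne_zero
  simp only [Mker, Kk, Hk, PiLp.sub_apply]
  simp only [div_eq_mul_inv, mul_inv, one_mul, inv_pow]
  ring

lemma Hk_trace (z : E3) : ∑ k, Hk k k z = 2 * ‖z‖⁻¹ := by
  simp only [Hk, if_true, one_mul]
  rw [Finset.sum_sub_distrib, ← Finset.sum_mul, norm_sq_sum]
  by_cases hz : z = 0
  · simp [hz]
  have h0 : ‖z‖ ≠ 0 := by simpa using hz
  simp
  field_simp
  norm_num

lemma fundamental0 {ψ : E3 → ℝ} (hψ : ContDiff ℝ (⊤ : ℕ∞) ψ) (hc : HasCompactSupport ψ)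
    (i j : Fin 3) :
    ∫ z, (Kk i j z * lap ψ z + ∑ k, Kk k j z * pd i (pd k ψ) z)
      = -((if i = j then 1 else 0) * ψ 0) := by
  have d1 : ∀ k, ContDiff ℝ (⊤ : ℕ∞) (pd k ψ) := fun k => contDiff_pd hψ k
  have d2 : ∀ k l, ContDiff ℝ (⊤ : ℕ∞) (pd k (pd l ψ)) := fun k l => contDiff_pd (d1 l) k
  have s1 : ∀ k, HasCompactSupport (pd k ψ) := fun k => hcs_pd hc k
  have s2 : ∀ k l, HasCompactSupport (pd k (pd l ψ)) := fun k l => hcs_pd (s1 l) k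
  have c1 : ∀ k, ∫ z, Hk k j z * pd i (pd k ψ) z = ∫ z, Hk k k z * pd i (pd j ψ) z := by
    intro k
    rw [lemmaB (d2 i k) (s2 i k), lemmaB (d2 i j) (s2 i j)]
    rw [pd_comm (d1 k) j i, pd_comm hψ j k, pd_comm (d1 j) i k]
  have c2 : ∀ k, ∫ z, Hk i j z * pd k (pd k ψ) z = ∫ z, Hk k k z * pd i (pd j ψ) z := by
    intro k
    rw [lemmaB (d2 k k) (s2 k k), lemmaB (d2 i j) (s2 i j)]
    rw [pd_comm (d1 k) j k, pd_comm hψ j k, pd_comm (d2 k j) i k, pd_comm (d1 j) i k]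
  have c3 : ∑ k, ∫ z, Hk k k z * pd i (pd j ψ) z = 2 * ∫ z, ‖z‖⁻¹ * pd i (pd j ψ) z := by
    rw [← integral_finsetSum _ fun k _ => integrable_Hk_mul k k (d2 i j).continuous (s2 i j),
      ← integral_const_mul]
    congr 1
    funext z
    rw [← Finset.sum_mul, Hk_trace, mul_assoc]
  have c4 : ∫ z, Hk i j z * lap ψ z = 2 * ∫ z, ‖z‖⁻¹ * pd i (pd j ψ) z := by
    rw [← c3]
    simp only [lap, Finset.mul_sum]
    rw [integral_finsetSum _ fun k _ => integrable_Hk_mul i j (d2 k k).continuous (s2 k k)]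
    exact Finset.sum_congr rfl fun k _ => c2 k
  have c5 : ∫ z, ∑ k, Hk k j z * pd i (pd k ψ) z = 2 * ∫ z, ‖z‖⁻¹ * pd i (pd j ψ) z := by
    rw [← c3]
    rw [integral_finsetSum _ fun k _ => integrable_Hk_mul k j (d2 i k).continuous (s2 i k)]
    exact Finset.sum_congr rfl fun k _ => c1 k
  have hl := (lap_cd hψ).continuous
  have i1 := (integrable_inv_mul' hl (lap_hcs hc)).const_mul (4 * (if i = j then (1 : ℝ) else 0))
  have i2 := integrable_Hk_mul i j hl (lap_hcs hc)
  have i3 := (integrable_inv_mul' (d2 i j).continuous (s2 i j)).const_mul 4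
  have i4 : Integrable (fun z => ∑ k, Hk k j z * pd i (pd k ψ) z) :=
    integrable_finsetSum _ fun k _ => integrable_Hk_mul k j (d2 i k).continuous (s2 i k)
  have e : ∀ z, Kk i j z * lap ψ z + ∑ k, Kk k j z * pd i (pd k ψ) z
      = (1 / (16 * Real.pi)) * (((4 * (if i = j then (1 : ℝ) else 0)) * (‖z‖⁻¹ * lap ψ z)
        - Hk i j z * lap ψ z) + (4 * (‖z‖⁻¹ * pd i (pd j ψ) z)
        - ∑ k, Hk k j z * pd i (pd k ψ) z)) := by
    intro z
    have : ∑ k, Kk k j z * pd i (pd k ψ) z = (1 / (16 * Real.pi)) *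
        (∑ k, (if k = j then 4 * (‖z‖⁻¹ * pd i (pd k ψ) z) else 0)
          - ∑ k, Hk k j z * pd i (pd k ψ) z) := by
      rw [← Finset.sum_sub_distrib, Finset.mul_sum]
      refine Finset.sum_congr rfl fun k _ => ?_
      unfold Kk
      split_ifs <;> ring
    rw [this, Finset.sum_ite_eq' Finset.univ j]
    simp only [Finset.mem_univ, if_true, Kk]
    ring
  simp_rw [e]
  have i12 : Integrable (fun z => (4 * (if i = j then (1 : ℝ) else 0)) * (‖z‖⁻¹ * lap ψ z)
      - Hk i j z * lap ψ z) := i1.sub i2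
  have i34 : Integrable (fun z => 4 * (‖z‖⁻¹ * pd i (pd j ψ) z)
      - ∑ k, Hk k j z * pd i (pd k ψ) z) := i3.sub i4
  rw [integral_const_mul, integral_add i12 i34, integral_sub i1 i2,
    integral_sub i3 i4, integral_const_mul, integral_const_mul, c4, c5, lemmaA hψ hc]
  have hpi := Real.pi_ne_zero
  field_simp
  ring

lemma fundamental {φ : E3 → ℝ} (hφ : ContDiff ℝ (⊤ : ℕ∞) φ) (hc : HasCompactSupport φ)
    (i j : Fin 3) (y : E3) :
    ∫ x, (Mker i j x y * lap φ x + ∑ k, Mker k j x y * pd i (pd k φ) x)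
      = -((if i = j then 1 else 0) * φ y) := by
  have hψ : ContDiff ℝ (⊤ : ℕ∞) (fun z => φ (z + y)) := hφ.comp (contDiff_id.add contDiff_const)
  have hcψ : HasCompactSupport (fun z => φ (z + y)) :=
    hc.comp_homeomorph (Homeomorph.addRight y)
  have h := fundamental0 hψ hcψ i j
  have p1 : ∀ (f : E3 → ℝ) k, pd k (fun z => f (z + y)) = fun z => pd k f (z + y) := by
    intro f k
    funext z
    simp only [pd]
    rw [fderiv_comp_add_right]
  rw [← integral_add_right_eq_self _ y]
  simp only [lap, p1, zero_add] at h ⊢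
  rw [← h]
  simp only [Mker_eq, add_sub_cancel_right]

lemma Kk_bound (i j : Fin 3) (z : E3) : |Kk i j z| ≤ ‖z‖⁻¹ := by
  have h1 := Hk_bound i j z
  have hn : 0 ≤ ‖z‖⁻¹ := by positivity
  have h2 : |(4 * ((if i = j then 1 else 0) * ‖z‖⁻¹) - Hk i j z)| ≤ 6 * ‖z‖⁻¹ := by
    rw [abs_le] at h1 ⊢
    split_ifs <;> constructor <;> linarith [h1.1, h1.2]
  unfold Kk
  rw [abs_mul, abs_of_pos (by positivity)]
  have hp : 1 / (16 * Real.pi) ≤ 1 / 6 := by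
    apply one_div_le_one_div_of_le (by norm_num)
    linarith [Real.pi_gt_three]
  calc _ ≤ 1 / 6 * (6 * ‖z‖⁻¹) := mul_le_mul hp h2 (abs_nonneg _) (by norm_num)
    _ = _ := by ring

lemma measurable_Kk (i j : Fin 3) : Measurable (Kk i j) := by
  have := measurable_Hk i j
  unfold Kk
  fun_prop

lemma E_int {e : E3 → ℝ} (he : LocallyIntegrable e volume) (j : Fin 3)
    (h : ∀ᵐ x : E3, Integrable (fun y : E3 => Mker j j x y * e y)) :
    Integrable (fun y => (1 + ‖y‖)⁻¹ * ‖e y‖) := by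
  obtain ⟨x, hx⟩ := h.exists
  refine (hx.norm.const_mul (16 * Real.pi / 3 * (1 + ‖x‖))).mono' ?_ ?_
  · have h1 : Continuous fun y : E3 => (1 + ‖y‖)⁻¹ := by
      refine Continuous.inv₀ (by fun_prop) fun y => by positivity
    exact h1.aestronglyMeasurable.mul he.aestronglyMeasurable.norm
  · filter_upwards [Measure.ae_ne volume x] with y hy
    have h0 : 0 < ‖x - y‖ := by simpa [sub_eq_zero] using hy.symm
    rw [norm_mul, norm_norm, norm_mul, ← mul_assoc, Real.norm_of_nonneg (by positivity)]
    refine mul_le_mul_of_nonneg_right ?_ (norm_nonneg _)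
    have hm : 3 / (16 * Real.pi * ‖x - y‖) ≤ ‖Mker j j x y‖ := by
      refine le_trans ?_ (le_abs_self _)
      simp only [Mker, if_true]
      rw [div_eq_mul_one_div, mul_comm]
      refine mul_le_mul_of_nonneg_left ?_ (by positivity)
      have : 0 ≤ (x j - y j) * (x j - y j) / ‖x - y‖ ^ 2 :=
        div_nonneg (mul_self_nonneg _) (by positivity)
      linarith
    refine le_trans ?_ (mul_le_mul_of_nonneg_left hm (by positivity))
    have hpi := Real.pi_pos
    have e1 : 16 * Real.pi / 3 * (1 + ‖x‖) * (3 / (16 * Real.pi * ‖x - y‖))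
        = (1 + ‖x‖) / ‖x - y‖ := by field_simp
    rw [e1, inv_eq_one_div, div_le_div_iff₀ (by positivity) h0]
    have := norm_sub_le x y
    nlinarith [norm_nonneg x, norm_nonneg y, mul_nonneg (norm_nonneg x) (norm_nonneg y)]

lemma prod_int {e : E3 → ℝ} (he : LocallyIntegrable e volume)
    (hi : Integrable (fun y => (1 + ‖y‖)⁻¹ * ‖e y‖)) (i j : Fin 3)
    {ψ : E3 → ℝ} (hψ : Measurable ψ) {C R : ℝ} (hC0 : 0 ≤ C) (hR : 0 ≤ R)
    (hC : ∀ x, |ψ x| ≤ C) (hs : ∀ x, R < ‖x‖ → ψ x = 0) :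
    Integrable (fun p : E3 × E3 => Mker i j p.1 p.2 * e p.2 * ψ p.1)
      ((volume : Measure E3).prod volume) := by
  have g1 := (hi.convolution_integrand (ContinuousLinearMap.mul ℝ ℝ) integrable_kloc).const_mul
    (C * (1 + R))
  have hb : Integrable ((Metric.closedBall (0 : E3) R).indicator (fun _ => C * (2 + R))) := by
    rw [integrable_indicator_iff measurableSet_closedBall]
    exact integrableOn_const (measure_closedBall_lt_top.ne)
  have g2 := hb.mul_prod hi
  refine (g1.add g2).mono' ?_ (ae_of_all _ fun p => ?_)
  · refine (AEStronglyMeasurable.mul ?_ he.aestronglyMeasurable.comp_snd).mul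
      (hψ.comp measurable_fst).aestronglyMeasurable
    simp only [Mker_eq]
    exact ((measurable_Kk i j).comp (measurable_fst.sub measurable_snd)).aestronglyMeasurable
  · obtain ⟨x, y⟩ := p
    simp only [Pi.add_apply, ContinuousLinearMap.mul_apply']
    have hk := kloc_nonneg (x - y)
    by_cases hx : R < ‖x‖
    · rw [hs x hx, mul_zero, norm_zero]
      have : 0 ≤ (Metric.closedBall (0 : E3) R).indicator (fun _ => C * (2 + R)) x :=
        Set.indicator_nonneg (fun _ _ => by positivity) x
      positivity
    · have hx' : ‖x‖ ≤ R := not_lt.1 hx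
      rw [Set.indicator_of_mem (by simpa using hx')]
      rw [norm_mul, norm_mul, Mker_eq]
      have a1 := Kk_bound i j (x - y)
      have a2 : ‖x - y‖⁻¹ ≤ (1 + ‖y‖)⁻¹ * ((1 + R) * kloc (x - y) + (2 + R)) := by
        have hz : ‖x - y‖⁻¹ ≤ (1 + ‖y‖)⁻¹ * ((1 + R) * ‖x - y‖⁻¹ + 1) := by
          by_cases h0 : ‖x - y‖ = 0
          · rw [h0]; simp; positivity
          have h0' : 0 < ‖x - y‖ := lt_of_le_of_ne (norm_nonneg _) (Ne.symm h0)
          rw [inv_mul_eq_div, le_div_iff₀ (by positivity)]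
          have t : ‖y‖ ≤ ‖x‖ + ‖x - y‖ := by
            have := norm_sub_le x (x - y)
            simpa using this
          have := mul_le_mul_of_nonneg_left (show 1 + ‖y‖ ≤ 1 + R + ‖x - y‖ by linarith)
            (inv_nonneg.2 h0'.le)
          rw [mul_add ‖x - y‖⁻¹ (1 + R), inv_mul_cancel₀ h0] at this
          linarith
        refine hz.trans (mul_le_mul_of_nonneg_left ?_ (by positivity))
        have := mul_le_mul_of_nonneg_left (inv_norm_le (x - y)) (show 0 ≤ 1 + R by linarith)
        linarith
      calc ‖Kk i j (x - y)‖ * ‖e y‖ * ‖ψ x‖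
          ≤ ((1 + ‖y‖)⁻¹ * ((1 + R) * kloc (x - y) + (2 + R))) * ‖e y‖ * C := by
            refine mul_le_mul (mul_le_mul_of_nonneg_right (a1.trans a2) (norm_nonneg _))
              (hC x) (norm_nonneg _) (by positivity)
        _ = _ := by ring

lemma test_bounds {ψ : E3 → ℝ} (hψ : Continuous ψ) (hc : HasCompactSupport ψ) :
    ∃ C R : ℝ, 0 ≤ C ∧ 0 ≤ R ∧ (∀ x, |ψ x| ≤ C) ∧ ∀ x, R < ‖x‖ → ψ x = 0 := by
  obtain ⟨C, hC⟩ := hc.exists_bound_of_continuous hψ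
  obtain ⟨R, hR⟩ := hc.isCompact.isBounded.subset_closedBall (0 : E3)
  refine ⟨C, max R 0, (norm_nonneg _).trans (hC 0), le_max_right _ _, hC, fun x hx => ?_⟩
  by_contra h
  have := hR (subset_tsupport ψ h)
  rw [mem_closedBall_zero_iff] at this
  exact absurd (this.trans (le_max_left R 0)) (not_le.2 hx)

/-- if `E ∈ L¹_loc` and `y ↦ M_{ij}(x,y)E^j(y)` is integrable for a.e. `x`,
then `W` is in `L¹_loc` and solves `-ΔW^i - ∂_i(∂_j W^j) = E^i` distributionally. -/
theorem stmt5 (Evec : Fin 3 → E3 → ℝ)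
    (hE : ∀ j : Fin 3, LocallyIntegrable (Evec j) volume)
    (hint : ∀ i j : Fin 3, ∀ᵐ x : E3, Integrable (fun y : E3 => Mker i j x y * Evec j y)) :
    (∀ i : Fin 3, LocallyIntegrable (Wsol Evec i) volume)
    ∧ ∀ (i : Fin 3) (φ : E3 → ℝ), ContDiff ℝ (⊤ : ℕ∞) φ → HasCompactSupport φ →
        (∫ x : E3, (Wsol Evec i x * lap φ x
            + ∑ j : Fin 3, Wsol Evec j x * pd i (pd j φ) x))
          = -∫ x : E3, Evec i x * φ x := by
  have hEi : ∀ j, Integrable (fun y => (1 + ‖y‖)⁻¹ * ‖Evec j y‖) :=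
    fun j => E_int (hE j) j (hint j j)
  constructor
  · intro i
    rw [locallyIntegrable_iff]
    intro K hK
    obtain ⟨R, hR⟩ := hK.isBounded.subset_closedBall (0 : E3)
    have hR' : K ⊆ Metric.closedBall (0 : E3) (max R 0) :=
      hR.trans (Metric.closedBall_subset_closedBall (le_max_left _ _))
    refine IntegrableOn.mono_set ?_ hR'
    rw [← integrable_indicator_iff measurableSet_closedBall]
    have hP : ∀ j, Integrable (fun x => ∫ y, Mker i j x y * Evec j y *
        (Metric.closedBall (0 : E3) (max R 0)).indicator (fun _ => (1 : ℝ)) x) := by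
      intro j
      refine (prod_int (hE j) (hEi j) i j
        (ψ := (Metric.closedBall (0 : E3) (max R 0)).indicator (fun _ => (1 : ℝ)))
        (measurable_const.indicator measurableSet_closedBall) (C := 1) (R := max R 0)
        zero_le_one (le_max_right _ _) (fun x => ?_) (fun x hx => ?_)).integral_prod_left
      · by_cases h : x ∈ Metric.closedBall (0 : E3) (max R 0)
        · rw [Set.indicator_of_mem h]; simp
        · rw [Set.indicator_of_notMem h]; simp
      · refine Set.indicator_of_notMem ?_ _
        rw [mem_closedBall_zero_iff]
        exact not_le.2 hx
    refine (integrable_finsetSum Finset.univ fun j _ => hP j).congr (ae_of_all _ fun x => ?_)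
    simp only [integral_mul_const]
    rw [← Finset.sum_mul]
    by_cases h : x ∈ Metric.closedBall (0 : E3) (max R 0)
    · rw [Set.indicator_of_mem h, Set.indicator_of_mem h, mul_one, Wsol]
    · rw [Set.indicator_of_notMem h, Set.indicator_of_notMem h, mul_zero]
  · intro i φ hφ hc
    have hP : ∀ k j {ψ : E3 → ℝ}, Continuous ψ → HasCompactSupport ψ →
        Integrable (fun p : E3 × E3 => Mker k j p.1 p.2 * Evec j p.2 * ψ p.1)
          ((volume : Measure E3).prod volume) := by
      intro k j ψ h1 h2
      obtain ⟨C, R, a, b, c, d⟩ := test_bounds h1 h2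
      exact prod_int (hE j) (hEi j) k j h1.measurable a b c d
    have hl := (lap_cd hφ).continuous
    have hlc := lap_hcs hc
    have h2 : ∀ k, Continuous (pd i (pd k φ)) :=
      fun k => (contDiff_pd (contDiff_pd hφ k) i).continuous
    have h2c : ∀ k, HasCompactSupport (pd i (pd k φ)) := fun k => hcs_pd (hcs_pd hc k) i
    have hJ : ∀ j, Integrable (fun p : E3 × E3 => Mker i j p.1 p.2 * Evec j p.2 * lap φ p.1
        + ∑ k, Mker k j p.1 p.2 * Evec j p.2 * pd i (pd k φ) p.1)
          ((volume : Measure E3).prod volume) := fun j =>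
      (hP i j hl hlc).add (integrable_finsetSum _ fun k _ => hP k j (h2 k) (h2c k))
    have hae : ∀ᵐ x : E3, ∀ k j, Integrable (fun y : E3 => Mker k j x y * Evec j y) := by
      rw [ae_all_iff]; intro k
      rw [ae_all_iff]; exact hint k
    calc ∫ x : E3, (Wsol Evec i x * lap φ x + ∑ j : Fin 3, Wsol Evec j x * pd i (pd j φ) x)
        = ∫ x : E3, ∑ j, ∫ y, (Mker i j x y * Evec j y * lap φ x
            + ∑ k, Mker k j x y * Evec j y * pd i (pd k φ) x) := by
          refine integral_congr_ae ?_
          filter_upwards [hae] with x hx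
          have : ∀ j, ∫ y, (Mker i j x y * Evec j y * lap φ x
              + ∑ k, Mker k j x y * Evec j y * pd i (pd k φ) x)
              = (∫ y, Mker i j x y * Evec j y) * lap φ x
                + ∑ k, (∫ y, Mker k j x y * Evec j y) * pd i (pd k φ) x := by
            intro j
            rw [integral_add ((hx i j).mul_const _)
              (integrable_finsetSum _ fun k _ => (hx k j).mul_const _),
              integral_finsetSum _ fun k _ => (hx k j).mul_const _]
            simp only [integral_mul_const]
          simp only [this, Wsol]
          rw [Finset.sum_add_distrib, Finset.sum_mul, Finset.sum_comm]
          simp only [Finset.sum_mul]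
      _ = ∑ j, ∫ x, ∫ y, (Mker i j x y * Evec j y * lap φ x
            + ∑ k, Mker k j x y * Evec j y * pd i (pd k φ) x) :=
          integral_finsetSum _ fun j _ => (hJ j).integral_prod_left
      _ = ∑ j, ∫ y, ∫ x, (Mker i j x y * Evec j y * lap φ x
            + ∑ k, Mker k j x y * Evec j y * pd i (pd k φ) x) :=
          Finset.sum_congr rfl fun j _ => integral_integral_swap (hJ j)
      _ = ∑ j, (if i = j then -∫ y, Evec j y * φ y else 0) := by
          refine Finset.sum_congr rfl fun j _ => ?_
          have : ∀ y, ∫ x, (Mker i j x y * Evec j y * lap φ x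
              + ∑ k, Mker k j x y * Evec j y * pd i (pd k φ) x)
              = Evec j y * -((if i = j then 1 else 0) * φ y) := by
            intro y
            rw [← fundamental hφ hc i j y, ← integral_const_mul]
            congr 1
            funext x
            rw [mul_add, Finset.mul_sum]
            congr 1
            · ring
            · exact Finset.sum_congr rfl fun k _ => by ring
          simp only [this]
          split_ifs
          · rw [← integral_neg]; simp
          · simp
      _ = -∫ x : E3, Evec i x * φ x := by
          rw [Finset.sum_ite_eq Finset.univ i]; simp
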